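/- arXiv:2504.09239 — 3 statements merged into one kernel-verified Lean document; each statement's English description precedes it below -/
import Mathlib

section
/- Define b : ℕ → ℕ by letting b(n) be the number of L-submodules M ⊆ L with |L/M| = p^n. Then in the ring of formal power series ℤ⟦X⟧ one has (1 − X)^2 · ∑_{n≥0} b(n)·X^n = 1 − X + p·X^2. (Equivalently, the zeta function Z(L; s) = ∑_n b(n)p^{−ns} equals (1 − p^{−s} + p^{1−2s})/(1 − p^{−s})^2.) -/
noncomputable section

/-- The group algebra `ℤ_p[G]` for `G` cyclic of order `p`. -/
abbrev L (p : ℕ) [Fact p.Prime] : Type := MonoidAlgebra (PadicInt p) (Multiplicative (ZMod p))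

/-- The fixed generator `g` of `G`, viewed inside `L = ℤ_p[G]`. -/
def gL (p : ℕ) [Fact p.Prime] : L p :=
  MonoidAlgebra.of (PadicInt p) (Multiplicative (ZMod p)) (Multiplicative.ofAdd 1)

/-- The norm element `N = 1 + g + ⋯ + g^(p-1)` of `L`. -/
def NL (p : ℕ) [Fact p.Prime] : L p := ∑ i ∈ Finset.range p, gL p ^ i


/-- `e ∈ L` is a norm-lift if `p·1 = e·(g−1)^(p−1) + α·N` for some `α ∈ ℤ_p`. -/
def IsNormLift (p : ℕ) [Fact p.Prime] (e : L p) : Prop :=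
  ∃ α : PadicInt p, (p : L p) = e * (gL p - 1) ^ (p - 1) + α • NL p

/-- The submodule `(g−1)A` of an `ℤ_p[G]`-module `A`. -/
def commSub (p : ℕ) [Fact p.Prime] (A : Type) [AddCommGroup A] [Module (L p) A] :
    Submodule (L p) A :=
  LinearMap.range (LinearMap.lsmul (L p) A (gL p - 1))

/-- The fixed-point submodule `A^G = {x ∈ A : g·x = x}` of an `ℤ_p[G]`-module `A`. -/
def fixedSub (p : ℕ) [Fact p.Prime] (A : Type) [AddCommGroup A] [Module (L p) A] :
    Submodule (L p) A :=
  LinearMap.ker (LinearMap.lsmul (L p) A (gL p - 1))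

/-- An `ℤ_p[G]`-module has rank 1 if it is nonzero and generated by a single element. -/
def IsRankOne (p : ℕ) [Fact p.Prime] (A : Type) [AddCommGroup A] [Module (L p) A] : Prop :=
  Nontrivial A ∧ ∃ a : A, Submodule.span (L p) {a} = ⊤

structure Node (R : Type) [CommRing R] (p : ℕ) [Fact p.Prime] (x y : R) (φ : R →+* ZMod p) : Prop where
  hxy : x * y = 0
  hker : ∀ f, φ f = 0 ↔ ∃ a b, f = a * x + b * y
  hunit : ∀ f, φ f ≠ 0 → IsUnit f
  hx : ∀ n, x ^ n ≠ 0
  hy : ∀ n, y ^ n ≠ 0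

namespace Node
variable {R : Type} [CommRing R] {p : ℕ} [Fact p.Prime] {x y : R} {φ : R →+* ZMod p}

theorem swap (h : Node R p x y φ) : Node R p y x φ where
  hxy := by rw [mul_comm]; exact h.hxy
  hker := fun f => by
    rw [h.hker]
    exact ⟨fun ⟨a, b, e⟩ => ⟨b, a, by rw [e, add_comm]⟩, fun ⟨a, b, e⟩ => ⟨b, a, by rw [e, add_comm]⟩⟩
  hunit := h.hunit
  hx := h.hy
  hy := h.hx

theorem phix (h : Node R p x y φ) : φ x = 0 := (h.hker x).2 ⟨1, 0, by ring⟩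
theorem phiy (h : Node R p x y φ) : φ y = 0 := h.swap.phix

theorem unit_ne (_ : Node R p x y φ) {u : R} (hu : IsUnit u) : φ u ≠ 0 := (hu.map φ).ne_zero

theorem xpow_y (h : Node R p x y φ) {n : ℕ} (hn : 1 ≤ n) : x ^ n * y = 0 := by
  obtain ⟨k, rfl⟩ := Nat.exists_eq_add_of_le hn
  rw [add_comm, pow_succ, mul_assoc, h.hxy, mul_zero]

theorem xpow_ypow (h : Node R p x y φ) {n m : ℕ} (hn : 1 ≤ n) (hm : 1 ≤ m) : x ^ n * y ^ m = 0 := by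
  obtain ⟨k, rfl⟩ := Nat.exists_eq_add_of_le hm
  rw [pow_add, pow_one, ← mul_assoc, h.xpow_y hn, zero_mul]

/-- `u x^n = a x^k`, `n<k`, `u` unit is impossible -/
theorem no_pow (h : Node R p x y φ) {n k : ℕ} (hk : n < k) {u a : R} (hu : IsUnit u)
    (e : u * x ^ n = a * x ^ k) : False := by
  obtain ⟨d, rfl⟩ := Nat.exists_eq_add_of_lt hk
  have h1 : (u - a * x ^ (d + 1)) * x ^ n = 0 := by
    rw [sub_mul, e]; ring
  have h2 : IsUnit (u - a * x ^ (d + 1)) := by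
    apply h.hunit
    simp [h.phix, h.unit_ne hu]
  exact h.hx n (h2.mul_right_eq_zero.1 h1)

def T1 (x y : R) (s t : ℕ) : Ideal R := Ideal.span {x ^ s, y ^ t}
def T2 (x y : R) (i j : ℕ) (u : R) : Ideal R := Ideal.span {x ^ i + u * y ^ j}

theorem mem_T1 {s t : ℕ} {f : R} : f ∈ T1 x y s t ↔ ∃ a b, a * x ^ s + b * y ^ t = f :=
  Ideal.mem_span_pair
theorem mem_T2 {i j : ℕ} {u f : R} : f ∈ T2 x y i j u ↔ ∃ c, c * (x ^ i + u * y ^ j) = f :=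
  Ideal.mem_span_singleton'

theorem T1_swap (s t : ℕ) : T1 x y s t = T1 y x t s := by
  unfold T1; rw [Set.pair_comm]

/-- unit times x^n in T1 s t -/
theorem le_of_mem_T1 (h : Node R p x y φ) {n s t : ℕ} (ht : 1 ≤ t)
    {u v : R} (hu : IsUnit u) (m : ℕ) (hm : 1 ≤ m) (hf : u * x ^ n + v * y ^ m ∈ T1 x y s t) : s ≤ n := by
  by_contra! hlt
  obtain ⟨a, b, e⟩ := mem_T1.1 hf
  have e1 := h.swap.xpow_y ht
  have e2 := h.swap.xpow_y hm
  refine h.no_pow (n := n + 1) (k := s + 1) (by omega) hu (a := a) ?_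
  have := congrArg (· * x) e
  simp only [add_mul, mul_assoc, e1, e2] at this
  simp only [pow_succ]
  simpa using this.symm

theorem xs_mem_T2 (h : Node R p x y φ) {i j : ℕ} (hj : 1 ≤ j) {u : R} : x ^ (i + 1) ∈ T2 x y i j u := by
  refine mem_T2.2 ⟨x, ?_⟩
  have := h.swap.xpow_y hj
  linear_combination u * this

theorem yt_mem_T2 (h : Node R p x y φ) {i j : ℕ} (hi : 1 ≤ i) {u : R} (hu : IsUnit u) :
    y ^ (j + 1) ∈ T2 x y i j u := by
  obtain ⟨v, hv⟩ := hu.exists_left_inv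
  refine mem_T2.2 ⟨v * y, ?_⟩
  have := h.xpow_y hi
  linear_combination v * this + y ^ (j + 1) * hv

theorem T1_le_T2 (h : Node R p x y φ) {i j : ℕ} (hi : 1 ≤ i) (hj : 1 ≤ j) {u : R} (hu : IsUnit u) :
    T1 x y (i+1) (j+1) ≤ T2 x y i j u := by
  unfold T1
  rw [Ideal.span_le]
  rintro f (rfl | rfl)
  · exact h.xs_mem_T2 hj
  · exact h.yt_mem_T2 hi hu

theorem T2_swap {i j : ℕ} {u v : R} (huv : v * u = 1) : T2 x y i j u = T2 y x j i v := by
  apply le_antisymm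
  · unfold T2; rw [Ideal.span_le]; rintro f rfl
    exact mem_T2.2 ⟨u, by linear_combination x ^ i * huv⟩
  · unfold T2; rw [Ideal.span_le]; rintro f rfl
    exact mem_T2.2 ⟨v, by linear_combination y ^ j * huv⟩

theorem gen_not_mem_T1 (h : Node R p x y φ) {i j : ℕ} (hj : 1 ≤ j) {u : R} :
    x ^ i + u * y ^ j ∉ T1 x y (i+1) (j+1) := by
  intro hm
  have hm' : 1 * x ^ i + u * y ^ j ∈ T1 x y (i+1) (j+1) := by rw [one_mul]; exact hm
  have := h.le_of_mem_T1 (by omega) isUnit_one j hj hm'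
  omega

/-- unit times x^n in T2 forces i+1 ≤ n -/
theorem le_of_mem_T2 (h : Node R p x y φ) {n i j : ℕ} (hn : 1 ≤ n) (hi : 1 ≤ i) (hj : 1 ≤ j)
    {u w : R} (hu : IsUnit u) (hw : IsUnit w) (hf : w * x ^ n ∈ T2 x y i j u) : i + 1 ≤ n := by
  obtain ⟨c, e⟩ := mem_T2.1 hf
  by_cases hc : φ c = 0
  · obtain ⟨a, b, rfl⟩ := (h.hker c).1 hc
    have h1 := h.swap.xpow_y hj
    have h2 := h.xpow_y hi
    refine h.le_of_mem_T1 (t := j + 1) (v := 0) (by omega) hw 1 le_rfl ?_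
    refine mem_T1.2 ⟨a, b * u, ?_⟩
    linear_combination e - a * u * h1 - b * h2
  · exfalso
    have hc := h.hunit c hc
    have h1 := h.xpow_y hi
    have h2 := h.xpow_y hn
    refine h.swap.no_pow (n := j + 1) (k := j + 2) (by omega) (hc.mul hu) (a := 0) ?_
    linear_combination y * e - c * h1 + w * h2

theorem card_step (h : Node R p x y φ) (I J : Ideal R) (z : R) (hz : z ∉ I) (hxz : x * z ∈ I)
    (hyz : y * z ∈ I) (hJ : J = I ⊔ Ideal.span {z}) :
    Nat.card (R ⧸ I) = p * Nat.card (R ⧸ J) := by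
  have hle : I ≤ J := hJ ▸ le_sup_left
  rw [← Submodule.card_quotient_mul_card_quotient J I hle]
  congr 1
  have e1 : Submodule.map I.mkQ J = LinearMap.range (LinearMap.toSpanSingleton R (R ⧸ I) (I.mkQ z)) := by
    rw [hJ, Submodule.map_sup]
    have : Submodule.map I.mkQ I = ⊥ := by
      rw [eq_bot_iff, Submodule.map_le_iff_le_comap]; intro r hr; simpa using hr
    rw [this, bot_sup_eq, Ideal.span, Submodule.map_span, Set.image_singleton, LinearMap.range_toSpanSingleton]
  have e2 : LinearMap.ker (LinearMap.toSpanSingleton R (R ⧸ I) (I.mkQ z)) = RingHom.ker φ := by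
    ext r
    rw [LinearMap.mem_ker, LinearMap.toSpanSingleton_apply, ← map_smul, Submodule.mkQ_apply,
      Submodule.Quotient.mk_eq_zero, RingHom.mem_ker, smul_eq_mul]
    constructor
    · intro hr
      by_contra hne
      obtain ⟨v, hv⟩ := (h.hunit r hne).exists_left_inv
      apply hz
      have := I.mul_mem_left v hr
      rwa [← mul_assoc, hv, one_mul] at this
    · intro hr
      obtain ⟨a, b, rfl⟩ := (h.hker r).1 hr
      rw [add_mul, mul_assoc, mul_assoc]
      exact I.add_mem (I.mul_mem_left _ hxz) (I.mul_mem_left _ hyz)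
  rw [e1, ← Nat.card_congr (LinearMap.quotKerEquivRange _).toEquiv, e2,
    Nat.card_congr (RingHom.quotientKerEquivOfSurjective (ZMod.ringHom_surjective φ)).toEquiv, Nat.card_zmod]

theorem T1_succ_card (h : Node R p x y φ) {s t : ℕ} (hs : 1 ≤ s) (ht : 1 ≤ t) :
    Nat.card (R ⧸ T1 x y (s+1) t) = p * Nat.card (R ⧸ T1 x y s t) := by
  apply h.card_step _ _ (x ^ s)
  · intro hm
    have := h.le_of_mem_T1 (n := s) (u := 1) (v := 0) ht isUnit_one 1 le_rfl (by simpa using hm)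
    omega
  · exact mem_T1.2 ⟨1, 0, by ring⟩
  · rw [mul_comm, h.xpow_y hs]; exact zero_mem _
  · apply le_antisymm
    · unfold T1
      rw [Ideal.span_le]
      rintro f (rfl | rfl)
      · exact Ideal.mem_sup_right (Ideal.mem_span_singleton_self _)
      · exact Ideal.mem_sup_left (Ideal.subset_span (by simp))
    · rw [sup_le_iff]
      unfold T1
      rw [Ideal.span_le, Ideal.span_le]
      refine ⟨?_, ?_⟩
      · rintro f (rfl | rfl)
        · exact mem_T1.2 ⟨x, 0, by ring⟩
        · exact Ideal.subset_span (by simp)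
      · rintro f rfl
        exact Ideal.subset_span (by simp)

theorem T1_card (h : Node R p x y φ) (s t : ℕ) :
    Nat.card (R ⧸ T1 x y (s+1) (t+1)) = p ^ (s + t + 1) := by
  induction s with
  | succ s ih => rw [h.T1_succ_card (by omega) (by omega), ih]; ring
  | zero =>
    induction t with
    | succ t ih =>
      rw [T1_swap, h.swap.T1_succ_card (by omega) (by omega), T1_swap, ih]; ring
    | zero =>
      have : T1 x y (0+1) (0+1) = RingHom.ker φ := by
        ext f
        rw [mem_T1, RingHom.mem_ker, h.hker]
        simp [eq_comm]
      rw [this, Nat.card_congr (RingHom.quotientKerEquivOfSurjective (ZMod.ringHom_surjective φ)).toEquiv, Nat.card_zmod]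
      simp

theorem T2_card (h : Node R p x y φ) {i j : ℕ} (hi : 1 ≤ i) (hj : 1 ≤ j) {u : R} (hu : IsUnit u) :
    Nat.card (R ⧸ T2 x y i j u) = p ^ (i + j) := by
  have h1 := h.T1_card i j
  rw [h.card_step _ (T2 x y i j u) (x ^ i + u * y ^ j) (h.gen_not_mem_T1 hj)] at h1
  · rw [pow_succ, mul_comm] at h1
    exact Nat.eq_of_mul_eq_mul_right (Fact.out : p.Prime).pos h1
  · have := h.swap.xpow_y hj
    exact mem_T1.2 ⟨1, 0, by linear_combination -u * this⟩
  · have := h.xpow_y hi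
    exact mem_T1.2 ⟨0, u, by linear_combination -this⟩
  · refine le_antisymm le_sup_right (sup_le (h.T1_le_T2 hi hj hu) le_rfl)

theorem decomp (h : Node R p x y φ) (a : R) (s : ℕ) (hs : 1 ≤ s) :
    (∃ c, a * x = c * x ^ s) ∨ ∃ i, 1 ≤ i ∧ i < s ∧ ∃ u, IsUnit u ∧ a * x = u * x ^ i := by
  induction s, hs using Nat.le_induction with
  | base => exact Or.inl ⟨a, by ring⟩
  | succ s hs ih =>
    rcases ih with ⟨c, hc⟩ | ⟨i, h1, h2, u, hu⟩
    · by_cases h0 : φ c = 0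
      · obtain ⟨c', d, rfl⟩ := (h.hker c).1 h0
        have := h.xpow_y hs
        exact Or.inl ⟨c', by linear_combination hc + d * this⟩
      · exact Or.inr ⟨s, hs, by omega, c, h.hunit c h0, hc⟩
    · exact Or.inr ⟨i, h1, by omega, u, hu⟩

theorem exists_pow_mem (h : Node R p x y φ) (I : Ideal R) [Finite (R ⧸ I)] : ∃ s, x ^ s ∈ I := by
  obtain ⟨a, b, hab, e⟩ := Finite.exists_ne_map_eq_of_infinite (fun n : ℕ => Ideal.Quotient.mk I (x ^ n))
  wlog hlt : a < b generalizing a b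
  · exact this b a hab.symm e.symm (by omega)
  obtain ⟨d, rfl⟩ := Nat.exists_eq_add_of_lt hlt
  refine ⟨a, ?_⟩
  have h1 := Ideal.Quotient.eq.1 e
  have h2 : IsUnit (1 - x ^ (d + 1)) := h.hunit _ (by simp [h.phix])
  obtain ⟨v, hv⟩ := h2.exists_left_inv
  have h3 := I.mul_mem_left v h1
  have : v * (x ^ a - x ^ (a + d + 1)) = x ^ a := by
    linear_combination x ^ a * hv
  rwa [this] at h3

theorem unit_mul_mem {I : Ideal R} {u f : R} (hu : IsUnit u) (hf : u * f ∈ I) : f ∈ I := by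
  obtain ⟨v, hv⟩ := hu.exists_left_inv
  have := I.mul_mem_left v hf
  rwa [← mul_assoc, hv, one_mul] at this

theorem classify (h : Node R p x y φ) (I : Ideal R) [Finite (R ⧸ I)] (hI : I ≠ ⊤) :
    (∃ s t, I = T1 x y (s+1) (t+1)) ∨
    ∃ i j u, 1 ≤ i ∧ 1 ≤ j ∧ 0 < u ∧ u < p ∧ I = T2 x y i j ((u : ℕ) : R) := by
  classical
  have ex := h.exists_pow_mem I
  have ey := h.swap.exists_pow_mem I
  have hs1 : 1 ≤ Nat.find ex := by
    rw [Nat.one_le_iff_ne_zero]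
    intro h0
    have := Nat.find_spec ex
    rw [h0, pow_zero] at this
    exact hI ((Ideal.eq_top_iff_one I).2 this)
  have ht1 : 1 ≤ Nat.find ey := by
    rw [Nat.one_le_iff_ne_zero]
    intro h0
    have := Nat.find_spec ey
    rw [h0, pow_zero] at this
    exact hI ((Ideal.eq_top_iff_one I).2 this)
  have hs := Nat.find_spec ex
  have ht := Nat.find_spec ey
  have hsm : ∀ n, x ^ n ∈ I → Nat.find ex ≤ n := fun n hn => Nat.find_min' ex hn
  have htm : ∀ n, y ^ n ∈ I → Nat.find ey ≤ n := fun n hn => Nat.find_min' ey hn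
  generalize Nat.find ex = s at *
  generalize Nat.find ey = t at *
  have hle : T1 x y s t ≤ I := by
    unfold T1; rw [Ideal.span_le]; rintro f (rfl | rfl) <;> assumption
  have key : ∀ f ∈ I, f ∈ T1 x y s t ∨ (2 ≤ s ∧ 2 ≤ t ∧
      ∃ u v, IsUnit u ∧ IsUnit v ∧ f - (u * x ^ (s-1) + v * y ^ (t-1)) = 0) ∨ 
       False := by
    intro f hf
    have hf0 : φ f = 0 := by
      by_contra hne
      exact hI (Ideal.eq_top_of_isUnit_mem _ hf (h.hunit f hne))
    obtain ⟨a, b, rfl⟩ := (h.hker f).1 hf0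
    rcases h.decomp a s hs1 with ⟨c, hc⟩ | ⟨i, hi1, his, u, hu, hau⟩ <;>
    rcases h.swap.decomp b t ht1 with ⟨d, hd⟩ | ⟨j, hj1, hjt, v, hv, hbv⟩
    · exact Or.inl (mem_T1.2 ⟨c, d, by rw [hc, hd]⟩)
    · exfalso
      have h1 : b * y ∈ I := by
        have := I.sub_mem hf (hc ▸ I.mul_mem_left c hs)
        simpa using this
      rw [hbv] at h1
      have := htm _ (unit_mul_mem hv h1)
      omega
    · exfalso
      have h1 : a * x ∈ I := by
        have := I.sub_mem hf (hd ▸ I.mul_mem_left d ht)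
        simpa using this
      rw [hau] at h1
      have := hsm _ (unit_mul_mem hu h1)
      omega
    · rw [hau, hbv] at hf ⊢
      have h1 := h.swap.xpow_y hj1
      have h2 := h.xpow_y hi1
      have h3 : x ^ (i+1) ∈ I := by
        apply unit_mul_mem hu
        convert I.mul_mem_left x hf using 1
        linear_combination -v * h1
      have h4 : y ^ (j+1) ∈ I := by
        apply unit_mul_mem hv
        convert I.mul_mem_left y hf using 1
        linear_combination -u * h2
      have h5 := hsm _ h3
      have h6 := htm _ h4
      obtain rfl : i = s - 1 := by omega
      obtain rfl : j = t - 1 := by omega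
      exact Or.inr (Or.inl ⟨by omega, by omega, u, v, hu, hv, by ring⟩)
  by_cases hge : I ≤ T1 x y s t
  · left
    refine ⟨s - 1, t - 1, ?_⟩
    rw [Nat.sub_add_cancel hs1, Nat.sub_add_cancel ht1]
    exact le_antisymm hge hle
  · right
    obtain ⟨f, hf, hfn⟩ := SetLike.not_le_iff_exists.1 hge
    rcases key f hf with h0 | ⟨hs2, ht2, u, v, hu, hv, e⟩ | h0
    · exact absurd h0 hfn
    · obtain ⟨i, rfl⟩ : ∃ i, s = i + 1 := ⟨s - 1, by omega⟩
      obtain ⟨j, rfl⟩ : ∃ j, t = j + 1 := ⟨t - 1, by omega⟩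
      simp only [Nat.add_sub_cancel] at *
      obtain ⟨u', hu'⟩ := hu.exists_left_inv
      have hφ : φ (u' * v) ≠ 0 := by
        apply h.unit_ne
        exact (IsUnit.of_mul_eq_one _ hu').mul hv
      have hmem : x ^ i + u' * v * y ^ j ∈ I := by
        convert I.mul_mem_left u' hf using 1
        linear_combination -u' * e - x ^ i * hu'
      have hpos : 0 < (φ (u' * v)).val := by
        rw [Nat.pos_iff_ne_zero, ne_eq, ZMod.val_eq_zero]; exact hφ
      have hlt := ZMod.val_lt (φ (u' * v))
      have hmem2 : x ^ i + (((φ (u' * v)).val : ℕ) : R) * y ^ j ∈ I := by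
        obtain ⟨a, b, hab⟩ := (h.hker ((((φ (u' * v)).val : ℕ) : R) - u' * v)).1 (by simp)
        have h1 := h.swap.xpow_y (n := j) (by omega)
        convert I.add_mem hmem (I.mul_mem_left b ht) using 1
        linear_combination y ^ j * hab + a * h1
      generalize (φ (u' * v)).val = w at *
      have hwu : IsUnit (w : R) := by
        apply h.hunit
        rw [map_natCast, ne_eq, ZMod.natCast_eq_zero_iff]
        exact Nat.not_dvd_of_pos_of_lt hpos hlt
      refine ⟨i, j, w, by omega, by omega, hpos, hlt, ?_⟩
      have hT2 : T2 x y i j (w : R) ≤ I := by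
        unfold T2; rw [Ideal.span_le]; rintro f rfl; exact hmem2
      refine le_antisymm ?_ hT2
      intro f hf
      have hl := h.T1_le_T2 (i := i) (j := j) (by omega) (by omega) hwu
      rcases key f hf with h0 | ⟨-, -, u, v, hu, hv, e⟩ | h0
      · exact hl h0
      · have h2 : f - u * (x ^ i + w * y ^ j) ∈ I := I.sub_mem hf (I.mul_mem_left _ hmem2)
        have h3 : (v - u * w) * y ^ j ∈ I := by
          convert h2 using 1
          linear_combination -e
        have h4 : φ (v - u * w) = 0 := by
          by_contra hne
          have := htm _ (unit_mul_mem (h.hunit _ hne) h3)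
          omega
        obtain ⟨a, b, hab⟩ := (h.hker _).1 h4
        have h1 := h.swap.xpow_y (n := j) (by omega)
        have h5 : y ^ (j+1) ∈ T2 x y i j (w : R) := h.yt_mem_T2 (by omega) hwu
        have h6 : f = u * (x ^ i + w * y ^ j) + b * y ^ (j+1) := by
          linear_combination e + y ^ j * hab + a * h1
        rw [h6]
        exact Ideal.add_mem _ (mem_T2.2 ⟨u, rfl⟩) (Ideal.mul_mem_left _ _ h5)
      · exact h0.elim
    · exact h0.elim

theorem count_zero : Nat.card {M : Ideal R // Nat.card (R ⧸ M) = p ^ 0} = 1 := by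
  rw [Nat.card_eq_one_iff_unique]
  have key : ∀ M : Ideal R, Nat.card (R ⧸ M) = p ^ 0 → M = ⊤ := by
    intro M hM
    rw [pow_zero, Nat.card_eq_one_iff_unique] at hM
    exact Submodule.Quotient.subsingleton_iff.1 hM.1
  refine ⟨⟨fun a b => Subtype.ext ((key _ a.2).trans (key _ b.2).symm)⟩, ⟨⟨⊤, ?_⟩⟩⟩
  rw [pow_zero, Nat.card_eq_one_iff_unique]
  exact ⟨Submodule.Quotient.subsingleton_iff.2 rfl, ⟨0⟩⟩

theorem cast_unit (h : Node R p x y φ) {w : ℕ} (h0 : 0 < w) (h1 : w < p) : IsUnit (w : R) := by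
  apply h.hunit
  rw [map_natCast, ne_eq, ZMod.natCast_eq_zero_iff]
  exact Nat.not_dvd_of_pos_of_lt h0 h1

theorem T1_le (h : Node R p x y φ) {s t s' t' : ℕ} (e : T1 x y (s+1) (t+1) = T1 x y (s'+1) (t'+1)) : s' ≤ s := by
  have : 1 * x ^ (s+1) + 0 * y ^ 1 ∈ T1 x y (s'+1) (t'+1) := by
    rw [← e]; exact mem_T1.2 ⟨1, 0, by ring⟩
  have := h.le_of_mem_T1 (by omega) isUnit_one 1 le_rfl this
  omega

theorem T2_le (h : Node R p x y φ) {i j i' j' : ℕ} {u u' : R} (hi : 1 ≤ i') (hj : 1 ≤ j) (hj' : 1 ≤ j')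
    (hu' : IsUnit u') (e : T2 x y i j u = T2 x y i' j' u') : i' ≤ i := by
  have : 1 * x ^ (i+1) ∈ T2 x y i' j' u' := by
    rw [← e, one_mul]; exact h.xs_mem_T2 hj
  have := h.le_of_mem_T2 (by omega) hi hj' hu' isUnit_one this
  omega

theorem T2_u (h : Node R p x y φ) {i j : ℕ} {u v : R} (hi : 1 ≤ i) (hj : 1 ≤ j)
    (hu : IsUnit u) (e : T2 x y i j u = T2 x y i j v) : φ u = φ v := by
  by_contra hne
  have hw : IsUnit (u - v) := h.hunit _ (by rw [map_sub]; exact sub_ne_zero.2 hne)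
  obtain ⟨u', hu'⟩ := hu.exists_left_inv
  have h1 : (u - v) * y ^ j ∈ T2 x y i j u := by
    have a1 : x ^ i + u * y ^ j ∈ T2 x y i j u := mem_T2.2 ⟨1, by ring⟩
    have a2 : x ^ i + v * y ^ j ∈ T2 x y i j u := by rw [e]; exact mem_T2.2 ⟨1, by ring⟩
    convert Ideal.sub_mem _ a1 a2 using 1; ring
  rw [T2_swap hu'] at h1
  have := h.swap.le_of_mem_T2 hj hj hi (IsUnit.of_mul_eq_one _ hu') hw h1
  omega

theorem T1_ne_T2 (h : Node R p x y φ) {s t i j : ℕ} {u : R} (hi : 1 ≤ i) (hj : 1 ≤ j)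
    (hu : IsUnit u) (e : T1 x y (s+1) (t+1) = T2 x y i j u) : False := by
  obtain ⟨u', hu'⟩ := hu.exists_left_inv
  have a1 : 1 * x ^ (s+1) ∈ T2 x y i j u := by
    rw [← e]; exact mem_T1.2 ⟨1, 0, by ring⟩
  have a2 : 1 * y ^ (t+1) ∈ T2 y x j i u' := by
    rw [← T2_swap hu', ← e]; exact mem_T1.2 ⟨0, 1, by ring⟩
  have b1 := h.le_of_mem_T2 (by omega) hi hj hu isUnit_one a1
  have b2 := h.swap.le_of_mem_T2 (by omega) hj hi (IsUnit.of_mul_eq_one _ hu') isUnit_one a2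
  have a3 : 1 * x ^ i + u * y ^ j ∈ T1 x y (s+1) (t+1) := by
    rw [e]; exact mem_T2.2 ⟨1, by ring⟩
  have := h.le_of_mem_T1 (by omega) isUnit_one j hj a3
  have hs : s = i := by omega
  have a4 : u * y ^ j + 1 * x ^ i ∈ T1 y x (t+1) (s+1) := by
    rw [← T1_swap, e]; exact mem_T2.2 ⟨1, by ring⟩
  have := h.swap.le_of_mem_T1 (by omega) hu i hi a4
  omega

def par (x y : R) (p m : ℕ) : Fin (m+1) ⊕ (Fin m × Fin (p-1)) → Ideal R
  | .inl k => T1 x y (k+1) (m-k+1)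
  | .inr (k, u) => T2 x y (k+1) (m-k) ((u+1 : ℕ) : R)

theorem count_succ (h : Node R p x y φ) (m : ℕ) :
    Nat.card {M : Ideal R // Nat.card (R ⧸ M) = p ^ (m+1)} = (m + 1) + m * (p - 1) := by
  have hp := (Fact.out : p.Prime)
  have hcu : ∀ u : Fin (p-1), IsUnit (((u+1 : ℕ)) : R) := fun u => h.cast_unit (by omega) (by omega)
  have hc : ∀ z, Nat.card (R ⧸ par x y p m z) = p ^ (m+1) := by
    rintro (k | ⟨k, u⟩)
    · rw [par, h.T1_card]; congr 1; omega
    · rw [par, h.T2_card (by omega) (by omega) (hcu u)]; congr 1; omega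
  have hbij : Function.Bijective (fun z => (⟨par x y p m z, hc z⟩ : {M : Ideal R // Nat.card (R ⧸ M) = p ^ (m+1)})) := by
    constructor
    · rintro (k | ⟨k, u⟩) (k' | ⟨k', u'⟩) e <;> simp only [Subtype.mk.injEq, par] at e
      · have := h.T1_le e
        have := h.T1_le e.symm
        congr 1; ext; omega
      · exact (h.T1_ne_T2 (by omega) (by omega) (hcu _) e).elim
      · exact (h.T1_ne_T2 (by omega) (by omega) (hcu _) e.symm).elim
      · have := h.T2_le (by omega) (by omega) (by omega) (hcu _) e
        have := h.T2_le (by omega) (by omega) (by omega) (hcu _) e.symm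
        obtain rfl : k = k' := by ext; omega
        have := h.T2_u (by omega) (by omega) (hcu _) e
        rw [map_natCast, map_natCast] at this
        have := congrArg ZMod.val this
        rw [ZMod.val_natCast_of_lt (by omega), ZMod.val_natCast_of_lt (by omega)] at this
        obtain rfl : u = u' := by ext; omega
        rfl
    · rintro ⟨M, hM⟩
      have : Finite (R ⧸ M) := Nat.finite_of_card_ne_zero (by rw [hM]; exact (pow_pos hp.pos _).ne')
      have hne : M ≠ ⊤ := by
        rintro rfl
        have : Nat.card (R ⧸ (⊤ : Ideal R)) = 1 := by
          rw [Nat.card_eq_one_iff_unique]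
          exact ⟨Submodule.Quotient.subsingleton_iff.2 rfl, ⟨0⟩⟩
        rw [this] at hM
        exact absurd hM.symm (Nat.one_lt_pow (by omega) hp.one_lt).ne'
      rcases h.classify M hne with ⟨s, t, rfl⟩ | ⟨i, j, u, hi, hj, hu, hup, rfl⟩
      · rw [h.T1_card] at hM
        have := Nat.pow_right_injective hp.two_le hM
        refine ⟨.inl ⟨s, by omega⟩, Subtype.ext ?_⟩
        simp only [par]
        congr 1; omega
      · rw [h.T2_card hi hj (h.cast_unit hu hup)] at hM
        have := Nat.pow_right_injective hp.two_le hM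
        refine ⟨.inr (⟨i-1, by omega⟩, ⟨u-1, by omega⟩), Subtype.ext ?_⟩
        simp only [par]
        congr 2 <;> omega
  rw [← Nat.card_congr (Equiv.ofBijective _ hbij)]
  simp
end Node

section AuxL
variable {p : ℕ} [Fact p.Prime]

theorem gL_pow_p : gL p ^ p = 1 := by
  unfold gL
  rw [← map_pow, ← ofAdd_nsmul]
  have h1 : p • (1 : ZMod p) = 0 := by simp
  rw [h1, ofAdd_zero]
  exact MonoidHom.map_one _

/-- augmentation -/
def augL (p : ℕ) [Fact p.Prime] : L p →ₐ[PadicInt p] PadicInt p :=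
  MonoidAlgebra.lift (PadicInt p) (PadicInt p) (Multiplicative (ZMod p)) 1

theorem augL_g : augL p (gL p) = 1 := by
  simp [augL, gL]

theorem exists_pi (f : L p) : ∃ h, f = algebraMap (PadicInt p) (L p) (augL p f) + (gL p - 1) * h := by
  induction f using MonoidAlgebra.induction_on with
  | of a =>
    have h1 : MonoidAlgebra.of (PadicInt p) (Multiplicative (ZMod p)) a = gL p ^ (a.toAdd.val) := by
      unfold gL
      rw [← map_pow, ← ofAdd_nsmul]
      simp
    obtain ⟨c, hc⟩ := sub_dvd_pow_sub_pow (gL p) 1 (a.toAdd.val)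
    refine ⟨c, ?_⟩
    rw [h1, map_pow, augL_g, ← hc, one_pow, one_pow, map_one]
    ring
  | add f g hf hg =>
    obtain ⟨a, ha⟩ := hf
    obtain ⟨b, hb⟩ := hg
    refine ⟨a + b, ?_⟩
    rw [map_add, map_add]
    linear_combination ha + hb
  | smul r f hf =>
    obtain ⟨a, ha⟩ := hf
    refine ⟨r • a, ?_⟩
    rw [map_smul, smul_eq_mul, map_mul, Algebra.smul_def, Algebra.smul_def]
    linear_combination (algebraMap (PadicInt p) (L p) r) * ha

theorem pi_N : (gL p - 1) * NL p = 0 := by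
  unfold NL
  rw [mul_geom_sum, gL_pow_p, sub_self]

theorem augL_N : augL p (NL p) = p := by
  unfold NL
  simp [map_sum, map_pow, augL_g]

theorem p_eq : ∃ h, (p : L p) = NL p + (gL p - 1) * h := by
  obtain ⟨h, hh⟩ := exists_pi (NL p)
  rw [augL_N, map_natCast] at hh
  exact ⟨-h, by linear_combination -hh⟩

theorem pi_pow_p : ∃ r, (gL p - 1) ^ p = (p : L p) * r := by
  obtain ⟨r, hr⟩ := exists_add_pow_prime_eq (Fact.out : p.Prime) (gL p - 1) 1
  rw [sub_add_cancel, gL_pow_p, one_pow] at hr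
  exact ⟨-((gL p - 1) * r), by linear_combination -hr⟩

def phiL (p : ℕ) [Fact p.Prime] : L p →+* ZMod p := (PadicInt.toZMod).comp (augL p).toRingHom

theorem phiL_apply (f : L p) : phiL p f = PadicInt.toZMod (augL p f) := rfl

theorem isUnit_L (f : L p) (hf : phiL p f ≠ 0) : IsUnit f := by
  have hu : IsUnit (augL p f) := by
    by_contra hn
    apply hf
    rw [phiL_apply, ← RingHom.mem_ker, PadicInt.ker_toZMod]
    exact (IsLocalRing.mem_maximalIdeal _).2 hn
  obtain ⟨v, hv⟩ := (hu.pow p).exists_left_inv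
  obtain ⟨h, hh⟩ := exists_pi f
  obtain ⟨r, hr⟩ := exists_add_pow_prime_eq (Fact.out : p.Prime)
    (algebraMap (PadicInt p) (L p) (augL p f)) ((gL p - 1) * h)
  rw [← hh] at hr
  obtain ⟨q, hq⟩ := pi_pow_p (p := p)
  obtain ⟨k, hk⟩ : ∃ k, f ^ p = algebraMap (PadicInt p) (L p) (augL p f ^ p) + (p : L p) * k := by
    rw [hr, mul_pow, hq, map_pow]
    exact ⟨q * h ^ p + algebraMap (PadicInt p) (L p) (augL p f) * ((gL p - 1) * h) * r, by ring⟩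
  have hv' : algebraMap (PadicInt p) (L p) v * algebraMap (PadicInt p) (L p) (augL p f ^ p) = 1 := by
    rw [← map_mul, hv, map_one]
  have key : (⊤ : Submodule (PadicInt p) (L p)) ≤ (Ideal.span {f}).restrictScalars (PadicInt p) := by
    refine Submodule.le_of_le_smul_of_le_jacobson_bot (I := Ideal.span {(p : PadicInt p)}) Module.Finite.fg_top ?_ ?_
    · rw [IsLocalRing.jacobson_eq_maximalIdeal _ bot_ne_top, PadicInt.maximalIdeal_eq_span_p]
    · intro z _
      obtain ⟨n, hn⟩ : ∃ n, p = n + 1 := ⟨p - 1, by have := (Fact.out : p.Prime).pos; omega⟩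
      have e : z = (algebraMap (PadicInt p) (L p) v * z * f ^ n) * f
          + (p : PadicInt p) • (-(algebraMap (PadicInt p) (L p) v * k * z)) := by
        have hk' : f ^ n * f = algebraMap (PadicInt p) (L p) (augL p f ^ p) + (p : L p) * k := by
          rw [← hk, ← pow_succ, ← hn]
        rw [Algebra.smul_def, map_natCast]
        linear_combination -z * hv' - algebraMap (PadicInt p) (L p) v * z * hk'
      rw [e]
      refine Submodule.add_mem_sup ?_ ?_
      · exact Ideal.mem_span_singleton'.2 ⟨_, rfl⟩
      · exact Submodule.smul_mem_smul (Ideal.mem_span_singleton_self _) trivial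
  have h1 : (1 : L p) ∈ (Ideal.span {f}) := key (x := 1) trivial
  obtain ⟨a, ha⟩ := Ideal.mem_span_singleton'.1 h1
  exact IsUnit.of_mul_eq_one a (by rw [mul_comm]; exact ha)

theorem p_torsion (f : L p) (h : (p : L p) * f = 0) : f = 0 := by
  have h1 : (p : PadicInt p) • f = 0 := by
    rw [Algebra.smul_def, map_natCast]; exact h
  have hp : (p : PadicInt p) ≠ 0 := by
    exact_mod_cast (Fact.out : p.Prime).ne_zero
  ext a
  have := congrArg (fun q : L p => q.coeff a) h1
  simpa [hp] using this

theorem nodeL : Node (L p) p (gL p - 1) (NL p) (phiL p) where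
  hxy := pi_N
  hker := fun f => by
    obtain ⟨k, hk⟩ := p_eq (p := p)
    constructor
    · intro hf
      rw [phiL_apply, ← RingHom.mem_ker, PadicInt.ker_toZMod, PadicInt.maximalIdeal_eq_span_p] at hf
      obtain ⟨c, hc⟩ := Ideal.mem_span_singleton'.1 hf
      obtain ⟨h, hh⟩ := exists_pi f
      rw [← hc, map_mul, map_natCast] at hh
      exact ⟨h + algebraMap (PadicInt p) (L p) c * k, algebraMap (PadicInt p) (L p) c,
        by linear_combination hh + algebraMap (PadicInt p) (L p) c * hk⟩
    · rintro ⟨a, b, rfl⟩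
      simp [phiL_apply, augL_g, augL_N]
  hunit := isUnit_L
  hx := fun n => by
    induction n with
    | zero => simp
    | succ n ih =>
      intro h0
      obtain ⟨k, hk⟩ := p_eq (p := p)
      rcases Nat.eq_zero_or_pos n with rfl | hn
      · have hN : augL p (NL p) = p := augL_N
        have h1 : gL p - 1 = 0 := by simpa using h0
        have h2 : (MonoidAlgebra.of (PadicInt p) (Multiplicative (ZMod p)) (Multiplicative.ofAdd 1))
          = MonoidAlgebra.of (PadicInt p) (Multiplicative (ZMod p)) 1 := by
          rw [MonoidHom.map_one (MonoidAlgebra.of (PadicInt p) (Multiplicative (ZMod p)))]; exact sub_eq_zero.1 h1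
        have h3 := MonoidAlgebra.of_injective h2
        have : (1 : ZMod p) = 0 := Multiplicative.ofAdd.injective h3
        exact one_ne_zero this
      · apply ih
        apply p_torsion
        obtain ⟨m, rfl⟩ : ∃ m, n = m + 1 := ⟨n - 1, by omega⟩
        have := pi_N (p := p)
        linear_combination (gL p - 1) ^ (m+1) * hk + (gL p - 1) ^ m * this + k * h0
  hy := fun n hn => by
    have := congrArg (augL p) hn
    rw [map_pow, augL_N, map_zero] at this
    have hp : (p : PadicInt p) ≠ 0 := by
      exact_mod_cast (Fact.out : p.Prime).ne_zero
    exact pow_ne_zero n hp this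

end AuxL

open PowerSeries in
/-- if `b n` is the number of `L`-submodules `M ⊆ L` with `|L/M| = p^n`, then
`(1 − X)^2 · ∑ b(n)Xⁿ = 1 − X + pX²` in `ℤ⟦X⟧` (equivalently,
`Z(L;s) = (1 − p^{−s} + p^{1−2s})/(1 − p^{−s})²`). -/
theorem stmt_12 (p : ℕ) [Fact p.Prime] (b : ℕ → ℕ)
    (hb : ∀ n : ℕ, b n = Nat.card {M : Submodule (L p) (L p) // Nat.card (L p ⧸ M) = p ^ n}) :
    (1 - X) ^ 2 * PowerSeries.mk (fun n => (b n : ℤ))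
      = 1 - X + (p : ℤ⟦X⟧) * X ^ 2 := by
  have h0 : b 0 = 1 := by rw [hb]; exact Node.count_zero
  have hs : ∀ m, (b (m+1) : ℤ) = (m + 1) + m * ((p : ℤ) - 1) := by
    intro m
    have h1 : b (m+1) = (m + 1) + m * (p - 1) := by rw [hb]; exact nodeL.count_succ m
    rw [h1]
    push_cast [(Fact.out : p.Prime).one_le]
    ring
  have e : (1 - X : ℤ⟦X⟧) ^ 2 * PowerSeries.mk (fun n => (b n : ℤ))
      = PowerSeries.mk (fun n => (b n : ℤ)) - PowerSeries.mk (fun n => (b n : ℤ)) * X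
        - PowerSeries.mk (fun n => (b n : ℤ)) * X
        + PowerSeries.mk (fun n => (b n : ℤ)) * X * X := by ring
  have e2 : (1 - X + (p : ℤ⟦X⟧) * X ^ 2) = 1 - X + PowerSeries.C (p : ℤ) * X * X := by
    rw [map_natCast]; ring
  rw [e, e2]
  ext n
  rcases n with _ | _ | n
  · simp [h0]
  · have := hs 0
    simp only [map_add, map_sub, PowerSeries.coeff_succ_mul_X, PowerSeries.coeff_mk,
      PowerSeries.coeff_zero_mul_X, PowerSeries.coeff_one, PowerSeries.coeff_X, this, h0]
    simp [this, h0]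
  · have a1 := hs n
    have a2 := hs (n+1)
    rcases n with _ | n
    · simp [PowerSeries.coeff_succ_mul_X, PowerSeries.coeff_one, PowerSeries.coeff_X, h0] at a1 a2 ⊢
      linarith
    · have a0 := hs n
      simp only [map_add, map_sub, PowerSeries.coeff_succ_mul_X, PowerSeries.coeff_mk, PowerSeries.coeff_one, PowerSeries.coeff_X, PowerSeries.coeff_C, a0, a1, a2]
      push_cast
      ring
end
end

section
/- Let M be an L-submodule of L such that A = L/M is infinite and has no p-torsion (i.e. p·x = 0 implies x = 0 for x ∈ A). Then M = 0, or M = ℤ_p·N (the L-submodule generated by the norm element N, in which case A ≅ I_G), or M = I_G, the L-submodule generated by g−1 (in which case A ≅ ℤ_p with trivial G-action). -/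
noncomputable section

open Polynomial in
theorem aux_irr (p : ℕ) [hp : Fact p.Prime] : Irreducible (cyclotomic p (PadicInt p)) := by
  set F := (cyclotomic p (PadicInt p)).comp (X + C 1) with hF
  have hFm : F = ((cyclotomic p ℤ).comp (X + 1)).map (Int.castRingHom (PadicInt p)) := by
    rw [Polynomial.map_comp, map_cyclotomic]; simp [hF]
  have hmon : F.Monic := (cyclotomic.monic p _).comp_X_add_C 1
  have hdeg : F.natDegree = p - 1 := by
    rw [hF, natDegree_comp, natDegree_X_add_C, mul_one, natDegree_cyclotomic,
      Nat.totient_prime hp.out]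
  have hE := cyclotomic_comp_X_add_one_isEisensteinAt p
  have hPr : (Ideal.span {(p : PadicInt p)}).IsPrime :=
    (Ideal.span_singleton_prime PadicInt.prime_p.ne_zero).2 PadicInt.prime_p
  have hFE : F.IsEisensteinAt (Ideal.span {(p : PadicInt p)}) := by
    refine hmon.isEisensteinAt_of_mem_of_notMem hPr.ne_top (fun {i hi} => ?_) ?_
    · rw [hFm] at hi ⊢
      have := hE.isWeaklyEisensteinAt.map (Int.castRingHom (PadicInt p))
      have h2 := this.mem hi
      simpa [Ideal.map_span] using h2
    · have h0 : F.coeff 0 = p := by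
        rw [coeff_zero_eq_eval_zero, hF, eval_comp, cyclotomic_prime]
        simp [eval_geom_sum]
      rw [h0, Ideal.span_singleton_pow, Ideal.mem_span_singleton]
      rintro ⟨k, hk⟩
      have h1 : (1 : PadicInt p) = p * k := by
        apply mul_left_cancel₀ (PadicInt.prime_p (p := p)).ne_zero
        linear_combination hk
      exact PadicInt.prime_p.not_isUnit (IsUnit.of_mul_eq_one _ h1.symm)
  have hirr : Irreducible F := hFE.irreducible hPr hmon.isPrimitive
    (by rw [hdeg]; have := hp.out.two_le; omega)
  have : Irreducible (taylorEquiv (1 : PadicInt p) (cyclotomic p (PadicInt p))) := by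
    exact hirr
  exact (MulEquiv.irreducible_iff (taylorEquiv (1 : PadicInt p))).1 this

open Polynomial in
theorem aux_bez (p : ℕ) [hp : Fact p.Prime] (f : (PadicInt p)[X])
    (hf : ¬ cyclotomic p (PadicInt p) ∣ f) :
    ∃ (a b : (PadicInt p)[X]) (c : PadicInt p), c ≠ 0 ∧
      a * f + b * cyclotomic p (PadicInt p) = C c := by
  set K := FractionRing (PadicInt p)
  have hinj : Function.Injective (algebraMap (PadicInt p) K) := IsFractionRing.injective _ _
  have hm := cyclotomic.monic p (PadicInt p)
  have hirr := (hm.irreducible_iff_irreducible_map_fraction_map (K := K)).1 (aux_irr p)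
  have hnd : ¬ (cyclotomic p (PadicInt p)).map (algebraMap _ K) ∣ f.map (algebraMap _ K) := by
    rwa [map_dvd_map _ hinj hm]
  obtain ⟨u, v, huv⟩ := (hirr.coprime_iff_not_dvd).2 hnd
  obtain ⟨c, hc, hu⟩ := IsLocalization.integerNormalization_spec (nonZeroDivisors (PadicInt p)) u
  obtain ⟨d, hd, hv⟩ := IsLocalization.integerNormalization_spec (nonZeroDivisors (PadicInt p)) v
  set U := IsLocalization.integerNormalization (nonZeroDivisors (PadicInt p)) u
  set V := IsLocalization.integerNormalization (nonZeroDivisors (PadicInt p)) v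
  refine ⟨C c * V, C d * U, c * d, mul_ne_zero (nonZeroDivisors.ne_zero hc)
    (nonZeroDivisors.ne_zero hd), ?_⟩
  apply Polynomial.map_injective _ hinj
  rw [← algebraMap_smul K c, smul_eq_C_mul] at hu
  rw [← algebraMap_smul K d, smul_eq_C_mul] at hv
  simp only [Polynomial.map_add, Polynomial.map_mul, map_C, hu, hv, map_mul]
  linear_combination (C ((algebraMap _ K) c) * C ((algebraMap _ K) d)) * huv

theorem gL_pow (p : ℕ) [Fact p.Prime] : gL p ^ p = 1 := by
  rw [gL, ← map_pow, ← ofAdd_nsmul]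
  simp [MonoidAlgebra.one_def]

open Polynomial in
theorem aux_surj (p : ℕ) [Fact p.Prime] (x : L p) :
    ∃ f : (PadicInt p)[X], aeval (gL p) f = x := by
  induction x using MonoidAlgebra.induction_on with
  | of m =>
    refine ⟨X ^ (m.toAdd.val), ?_⟩
    rw [map_pow, aeval_X, gL, ← map_pow, ← ofAdd_nsmul]
    simp
  | add x y hx hy =>
    obtain ⟨f, rfl⟩ := hx
    obtain ⟨g, rfl⟩ := hy
    exact ⟨f + g, map_add _ _ _⟩
  | smul r x hx =>
    obtain ⟨f, rfl⟩ := hx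
    exact ⟨r • f, map_smul _ _ _⟩

theorem aux_sat (p : ℕ) [hp : Fact p.Prime] (M : Submodule (L p) (L p))
    (htf : ∀ x : L p ⧸ M, (p : L p) • x = 0 → x = 0) (c : PadicInt p) (hc : c ≠ 0) (x : L p)
    (hx : algebraMap (PadicInt p) (L p) c * x ∈ M) : x ∈ M := by
  have h1 : ∀ y : L p, (p : L p) * y ∈ M → y ∈ M := fun y hy => by
    have := htf (Submodule.Quotient.mk y) (by
      rw [← Submodule.Quotient.mk_smul, Submodule.Quotient.mk_eq_zero]; exact hy)
    rwa [Submodule.Quotient.mk_eq_zero] at this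
  have h2 : ∀ n : ℕ, (p : L p) ^ n * x ∈ M → x ∈ M := by
    intro n
    induction n with
    | zero => simp
    | succ n ih => intro h; exact ih (h1 _ (by rwa [pow_succ', mul_assoc] at h))
  apply h2 c.valuation
  have h3 := M.smul_mem (algebraMap (PadicInt p) (L p) ((PadicInt.unitCoeff hc)⁻¹ : (PadicInt p)ˣ)) hx
  have h4 := PadicInt.unitCoeff_spec hc
  have h5 : ((PadicInt.unitCoeff hc)⁻¹ : (PadicInt p)ˣ) * c = (p : PadicInt p) ^ c.valuation := by
    rw [Units.inv_mul_eq_iff_eq_mul]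
    exact h4
  rw [smul_eq_mul, ← mul_assoc, ← map_mul, h5, map_pow, map_natCast] at h3
  exact h3

open Polynomial in
theorem stmt_15 (p : ℕ) [Fact p.Prime] (M : Submodule (L p) (L p))
    (hinf : Infinite (L p ⧸ M))
    (htf : ∀ x : L p ⧸ M, (p : L p) • x = 0 → x = 0) :
    M = ⊥ ∨ M = Submodule.span (L p) {NL p} ∨ M = Submodule.span (L p) {gL p - 1} := by
  have hsat := aux_sat p M htf
  have hone : (1 : L p) ∉ M := fun h => by
    have : M = ⊤ := (Ideal.eq_top_iff_one M).2 h
    subst this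
    exact not_finite (L p ⧸ (⊤ : Submodule (L p) (L p)))
  have hN : aeval (gL p) (cyclotomic p (PadicInt p)) = NL p := by
    simp [cyclotomic_prime, NL]
  have hNt : NL p * (gL p - 1) = 0 := by
    rw [NL, geom_sum_mul, gL_pow, sub_self]
  have hdiv : ∀ f : (PadicInt p)[X], ∃ s : (PadicInt p)[X], f = (X - C 1) * s + C (f.eval 1) := by
    intro f
    obtain ⟨s, hs⟩ := X_sub_C_dvd_sub_C_eval (a := 1) (p := f)
    exact ⟨s, by rw [← hs]; ring⟩
  by_cases ht : gL p - 1 ∈ M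
  · right; right
    apply le_antisymm
    · intro x hx
      obtain ⟨f, rfl⟩ := aux_surj p x
      obtain ⟨s, hs⟩ := hdiv f
      have he : aeval (gL p) f = (gL p - 1) * aeval (gL p) s
          + algebraMap (PadicInt p) (L p) (f.eval 1) := by
        conv_lhs => rw [hs]
        simp
      by_cases h0 : f.eval 1 = 0
      · rw [he, h0, map_zero, add_zero]
        exact Ideal.mul_mem_right _ _ (Submodule.mem_span_singleton_self _)
      · exfalso
        apply hone
        apply hsat _ h0
        rw [mul_one]
        have := M.sub_mem hx (Ideal.mul_mem_right (aeval (gL p) s) M ht)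
        rwa [he, add_sub_cancel_left] at this
    · exact (Submodule.span_singleton_le_iff_mem _ _).2 ht
  · have key : ∀ x ∈ M, ∃ c : PadicInt p, x = algebraMap (PadicInt p) (L p) c * NL p := by
      intro x hx
      obtain ⟨f, rfl⟩ := aux_surj p x
      by_cases hd : cyclotomic p (PadicInt p) ∣ f
      · obtain ⟨q, rfl⟩ := hd
        obtain ⟨s, hs⟩ := hdiv q
        refine ⟨q.eval 1, ?_⟩
        rw [map_mul, hN]
        conv_lhs => rw [hs]
        simp only [map_add, map_mul, map_sub, aeval_X, aeval_C, map_one]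
        linear_combination (aeval (gL p) s) * hNt
      · exfalso
        obtain ⟨a, b, c, hc, h⟩ := aux_bez p f hd
        apply ht
        apply hsat c hc
        have h' := congrArg (aeval (gL p)) h
        simp only [map_add, map_mul, aeval_C, hN] at h'
        have : algebraMap (PadicInt p) (L p) c * (gL p - 1)
            = (aeval (gL p) a * (gL p - 1)) * aeval (gL p) f := by
          linear_combination (-(gL p - 1)) * h' + aeval (gL p) b * hNt
        rw [this]
        exact Ideal.mul_mem_left _ _ hx
    by_cases hb : M = ⊥
    · exact Or.inl hb
    · right; left
      obtain ⟨x, hx, hx0⟩ := Submodule.exists_mem_ne_zero_of_ne_bot hb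
      obtain ⟨c, rfl⟩ := key x hx
      have hc : c ≠ 0 := by
        rintro rfl
        simp at hx0
      apply le_antisymm
      · intro y hy
        obtain ⟨d, rfl⟩ := key y hy
        exact Ideal.mul_mem_left _ _ (Submodule.mem_span_singleton_self _)
      · exact (Submodule.span_singleton_le_iff_mem _ _).2 (hsat c hc _ hx)
end
end

section
/- Let M be an L-submodule of L such that A = L/M is infinite and the p-torsion submodule T(A) = {x ∈ A : p^k·x = 0 for some k ≥ 1} is nonzero of cardinality p^n (n ≥ 1). Then either M is the L-submodule of L generated by p^n·N, or M is the L-submodule of L generated by (g−1)^(n+1). -/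
noncomputable section

namespace S16

variable (p : ℕ) [Fact p.Prime]

abbrev π : L p := gL p - 1

abbrev am : PadicInt p →+* L p := algebraMap (PadicInt p) (L p)

def aug : L p →ₐ[PadicInt p] PadicInt p :=
  MonoidAlgebra.lift (PadicInt p) (PadicInt p) (Multiplicative (ZMod p)) 1

lemma aug_of (x) : aug p (MonoidAlgebra.of _ _ x) = 1 := by
  unfold aug
  rw [MonoidAlgebra.lift_of]; rfl

lemma aug_g : aug p (gL p) = 1 := aug_of p _

lemma aug_π : aug p (π p) = 0 := by
  rw [map_sub, aug_g, map_one, sub_self]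

lemma aug_am (c) : aug p (am p c) = c := by
  exact (aug p).commutes c

lemma aug_N : aug p (NL p) = p := by
  simp [NL, aug_g]

lemma gpow (k : ℕ) : gL p ^ k = MonoidAlgebra.of (PadicInt p) (Multiplicative (ZMod p))
    (Multiplicative.ofAdd (k : ZMod p)) := by
  rw [gL, ← map_pow, ← ofAdd_nsmul, nsmul_one]

lemma gp : gL p ^ p = 1 := by
  rw [gpow, ZMod.natCast_self, ofAdd_zero, map_one]

lemma πN : π p * NL p = 0 := by
  rw [NL, mul_geom_sum, gp, sub_self]

lemma dvd_sub_aug (x : L p) : π p ∣ x - am p (aug p x) := by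
  induction x using MonoidAlgebra.induction_on with
  | of m =>
    rw [aug_of, map_one]
    have : MonoidAlgebra.of (PadicInt p) _ m = gL p ^ (ZMod.val (Multiplicative.toAdd m)) := by
      rw [gpow, ZMod.natCast_val, ZMod.cast_id]; rfl
    rw [this]
    simpa using sub_dvd_pow_sub_pow (gL p) 1 (ZMod.val (Multiplicative.toAdd m))
  | add x y hx hy =>
    rw [map_add, map_add, add_sub_add_comm]; exact dvd_add hx hy
  | smul r x hx =>
    rw [map_smul, smul_eq_mul, map_mul, Algebra.smul_def, ← mul_sub]
    exact Dvd.dvd.mul_left hx _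

lemma decomp (x : L p) : ∃ y, x = am p (aug p x) + π p * y := by
  obtain ⟨y, hy⟩ := dvd_sub_aug p x
  exact ⟨y, by rw [← hy]; ring⟩

lemma aug_zero_iff (x : L p) : aug p x = 0 ↔ π p ∣ x := by
  constructor
  · intro h
    have := dvd_sub_aug p x
    rwa [h, map_zero, sub_zero] at this
  · rintro ⟨y, rfl⟩
    rw [map_mul, aug_π, zero_mul]

lemma N_mul (x : L p) : NL p * x = am p (aug p x) * NL p := by
  obtain ⟨y, hy⟩ := decomp p x
  conv_lhs => rw [hy]
  linear_combination y * πN p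

lemma coeff_am (c : PadicInt p) (x : L p) (i) : (am p c * x).coeff i = c * x.coeff i := by
  rw [← Algebra.smul_def]; rfl

lemma coeff_p (k : ℕ) (x : L p) (i) : ((p : L p) ^ k * x).coeff i = (p : PadicInt p) ^ k * x.coeff i := by
  rw [← coeff_am, map_pow, map_natCast]

lemma pz : (p : PadicInt p) ≠ 0 := by
  exact_mod_cast (Fact.out : p.Prime).ne_zero

lemma am_cancel (c : PadicInt p) (hc : c ≠ 0) (x : L p) (h : am p c * x = 0) : x = 0 := by
  ext i
  have := coeff_am p c x i
  rw [h] at this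
  simpa [hc] using this

lemma p_cancel (k : ℕ) (x : L p) (h : (p : L p) ^ k * x = 0) : x = 0 := by
  apply am_cancel p ((p : PadicInt p) ^ k) (pow_ne_zero _ (pz p))
  rwa [map_pow, map_natCast]

lemma dvd_of_coeff (k : ℕ) (x : L p) (h : ∀ i, (p : PadicInt p) ^ k ∣ x.coeff i) :
    (p : L p) ^ k ∣ x := by
  choose f hf using h
  refine ⟨MonoidAlgebra.ofCoeff (Finsupp.equivFunOnFinite.symm f), ?_⟩
  ext i
  rw [coeff_p, hf]; rfl

lemma coeffN : (NL p).coeff 1 = 1 := by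
  rw [NL, MonoidAlgebra.coeff_sum, Finsupp.finsetSum_apply, Finset.sum_eq_single 0]
  · simp [MonoidAlgebra.one_def]
  · intro b hb hb0
    rw [gpow, MonoidAlgebra.of_apply, MonoidAlgebra.coeff_single, Finsupp.single_eq_of_ne]
    intro h
    have h2 : ((b : ℕ) : ZMod p) = 0 := by
      have := congrArg Multiplicative.toAdd h
      simpa using this.symm
    rw [ZMod.natCast_eq_zero_iff] at h2
    exact hb0 (Nat.eq_zero_of_dvd_of_lt h2 (Finset.mem_range.1 hb))
  · intro h
    exact absurd (Finset.mem_range.2 (Fact.out : p.Prime).pos) h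

lemma exists_z : ∃ z, (p : L p) - NL p = π p * z := by
  have : π p ∣ (p : L p) - NL p := by
    rw [← aug_zero_iff, map_sub, aug_N]; simp
  exact this

lemma ann_π (x : L p) (h : π p * x = 0) : ∃ c, x = am p c * NL p := by
  obtain ⟨z, hz⟩ := exists_z p
  have h1 : (p : L p) * x = am p (aug p x) * NL p := by
    rw [← N_mul]; linear_combination x * hz + z * h
  have h2 : (p : PadicInt p) * x.coeff 1 = aug p x := by
    have := congrArg (fun y => y.coeff 1) h1
    simp only [coeff_am, coeffN, mul_one] at this
    rw [← this]
    simpa using (coeff_p p 1 x 1).symm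
  refine ⟨x.coeff 1, ?_⟩
  rw [← sub_eq_zero]
  apply p_cancel p 1
  rw [← h2, map_mul, map_natCast] at h1
  linear_combination h1

lemma π_ne : π p ≠ 0 := by
  intro h
  obtain ⟨c, hc⟩ := ann_π p 1 (by rw [h, zero_mul])
  have := congrArg (aug p) hc
  rw [map_one, map_mul, aug_am, aug_N] at this
  exact PadicInt.prime_p.not_isUnit (IsUnit.of_mul_eq_one c (by rw [mul_comm]; exact this.symm))

lemma π_sq (y : L p) (h : π p * (π p * y) = 0) : π p * y = 0 := by
  obtain ⟨c, hc⟩ := ann_π p _ h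
  have := congrArg (aug p) hc
  rw [map_mul, map_mul, aug_am, aug_N, aug_π, zero_mul] at this
  have hc0 : c = 0 := by
    rcases mul_eq_zero.1 this.symm with h | h
    · exact h
    · exact absurd h (pz p)
  rw [hc, hc0, map_zero, zero_mul]

lemma π_pow_ne (k : ℕ) : π p ^ (k+1) ≠ 0 := by
  induction k with
  | zero => simpa using π_ne p
  | succ k ih =>
    intro h
    apply ih
    rw [pow_succ']
    apply π_sq
    rw [← h]; ring

lemma π_pow_p : ∃ w, π p ^ p = p * w := by
  obtain ⟨r, hr⟩ := exists_add_pow_prime_eq (Fact.out : p.Prime) (π p) 1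
  rw [sub_add_cancel, gp] at hr
  exact ⟨- (π p * r), by rw [one_pow] at hr; linear_combination -hr⟩

lemma isUnit_of_aug (u : L p) (hu : IsUnit (aug p u)) : IsUnit u := by
  obtain ⟨y, hy⟩ := decomp p u
  obtain ⟨r, hr⟩ := exists_add_pow_prime_eq (Fact.out : p.Prime) (am p (aug p u)) (π p * y)
  obtain ⟨w, hw⟩ := π_pow_p p
  rw [← hy, mul_pow, hw] at hr
  obtain ⟨c, hc⟩ := hu.exists_right_inv
  have hc' : am p (aug p u) * am p c = 1 := by rw [← map_mul, hc, map_one]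
  have h1 : ∃ s t, u * s + (p : L p) * t = 1 := by
    refine ⟨u ^ (p - 1) * am p c ^ p, - (am p c ^ p * (w * y ^ p + am p (aug p u) * (π p * y) * r)), ?_⟩
    have e : u * (u ^ (p-1) * am p c ^ p) = u ^ p * am p c ^ p := by
      rw [← mul_assoc, ← pow_succ', Nat.sub_add_cancel (Fact.out : p.Prime).one_le]
    rw [e, hr]
    have e2 : am p (aug p u) ^ p * am p c ^ p = 1 := by rw [← mul_pow, hc', one_pow]
    linear_combination e2
  obtain ⟨s, t, hst⟩ := h1
  have key : (⊤ : Submodule (PadicInt p) (L p)) ≤ (Ideal.span {u}).restrictScalars (PadicInt p) := by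
    apply Submodule.le_of_le_smul_of_le_jacobson_bot (I := IsLocalRing.maximalIdeal (PadicInt p))
      (Module.Finite.fg_top)
    · rw [IsLocalRing.jacobson_eq_maximalIdeal _ bot_ne_top]
    · intro x _
      have : x = u * (s * x) + (p : PadicInt p) • (t * x) := by
        rw [Algebra.smul_def, map_natCast]; linear_combination - x * hst
      rw [this]
      apply Submodule.add_mem_sup
      · exact Ideal.mem_span_singleton.2 ⟨_, rfl⟩
      · apply Submodule.smul_mem_smul _ Submodule.mem_top
        rw [PadicInt.maximalIdeal_eq_span_p]
        exact Ideal.mem_span_singleton_self _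
  have := key (x := 1) trivial
  exact isUnit_of_dvd_one (Ideal.mem_span_singleton.1 this)

lemma not_unit_dvd (c : PadicInt p) (h : ¬ IsUnit c) : (p : PadicInt p) ∣ c := by
  rw [← Ideal.mem_span_singleton, ← PadicInt.maximalIdeal_eq_span_p]
  exact (IsLocalRing.mem_maximalIdeal _).2 h

lemma pπ : ∃ z, (p : L p) * π p = π p * (π p * z) := by
  obtain ⟨z, hz⟩ := exists_z p
  exact ⟨z, by linear_combination π p * hz + πN p⟩

lemma step (k : ℕ) (u : L p) (hu : (p : PadicInt p) ∣ aug p u) :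
    π p ^ (k+2) ∣ π p ^ (k+1) * u := by
  obtain ⟨y, hy⟩ := decomp p u
  obtain ⟨z, hz⟩ := pπ p
  obtain ⟨c, hc⟩ := hu
  refine ⟨z * am p c + y, ?_⟩
  rw [hc, map_mul, map_natCast] at hy
  rw [hy]
  linear_combination π p ^ k * am p c * hz

lemma inf_dvd (x : L p) (h : ∀ k, π p ^ k ∣ x) : x = 0 := by
  have h2 : ∀ k, (p : L p) ^ k ∣ x := by
    intro k
    obtain ⟨w, hw⟩ := π_pow_p p
    refine dvd_trans ?_ (h (p * k))
    rw [pow_mul, hw, mul_pow]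
    exact dvd_mul_right _ _
  ext i
  by_contra hne
  have hf : FiniteMultiplicity (p : PadicInt p) (x.coeff i) :=
    FiniteMultiplicity.of_not_isUnit PadicInt.prime_p.not_isUnit hne
  obtain ⟨n, hn⟩ := hf
  apply hn
  obtain ⟨y, hy⟩ := h2 (n+1)
  rw [hy, coeff_p]
  exact dvd_mul_right _ _

lemma exists_unit (x : L p) (hx : x ≠ 0) (hd : π p ∣ x) :
    ∃ k u, IsUnit u ∧ x = π p ^ (k+1) * u := by
  by_contra hcon
  push Not at hcon
  apply hx
  have : ∀ k, π p ^ (k+1) ∣ x := by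
    intro k
    induction k with
    | zero => simpa using hd
    | succ k ih =>
      obtain ⟨u, hu⟩ := ih
      have h1 : ¬ IsUnit (aug p u) := fun h => hcon k u (isUnit_of_aug p u h) hu
      rw [hu]
      exact step p k u (not_unit_dvd p _ h1)
  apply inf_dvd
  intro k
  exact (pow_dvd_pow _ (Nat.le_succ k)).trans (this k)

lemma card_tors (M : Submodule (L p) (L p)) (K : AddSubgroup (L p))
    (h : ∀ x, (∃ k : ℕ, 1 ≤ k ∧ (p : L p) ^ k * x ∈ M) ↔ x ∈ K) (hMK : M.toAddSubgroup ≤ K) :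
    Nat.card {x : L p ⧸ M // ∃ k : ℕ, 1 ≤ k ∧ (p : L p) ^ k • x = 0}
      = M.toAddSubgroup.relIndex K := by
  have h1 := AddSubgroup.relIndex_ker K (M.mkQ.toAddMonoidHom)
  have h2 : (M.mkQ.toAddMonoidHom).ker = M.toAddSubgroup := by
    ext x
    exact Submodule.Quotient.mk_eq_zero M
  rw [← h2, h1]
  refine Nat.card_congr (Equiv.subtypeEquivRight ?_)
  intro x
  obtain ⟨y, rfl⟩ := Submodule.mkQ_surjective M x
  have e : ∀ k : ℕ, (p : L p) ^ k • M.mkQ y = 0 ↔ (p : L p) ^ k * y ∈ M := by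
    intro k
    rw [← map_smul, Submodule.mkQ_apply, Submodule.Quotient.mk_eq_zero, smul_eq_mul]
  simp only [e, h]
  constructor
  · intro hy; exact ⟨y, hy, rfl⟩
  · rintro ⟨z, hz, hzy⟩
    have : z - y ∈ M := by
      rw [← Submodule.Quotient.mk_eq_zero, Submodule.Quotient.mk_sub, sub_eq_zero]; exact hzy
    have h3 := K.sub_mem hz (hMK this)
    simpa using h3

lemma index_of (M : AddSubgroup (L p)) (a : L p) (n : ℕ)
    (h : ∀ x, a * x ∈ M ↔ (p : PadicInt p) ^ n ∣ aug p x) :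
    M.relIndex (Submodule.span (L p) {a}).toAddSubgroup = p ^ n := by
  have h1 := AddSubgroup.index_comap M (AddMonoidHom.mulLeft a)
  have h2 : (AddMonoidHom.mulLeft a).range = (Submodule.span (L p) {a}).toAddSubgroup := by
    ext x
    simp only [AddMonoidHom.mem_range, AddMonoidHom.coe_mulLeft, Submodule.mem_toAddSubgroup,
      Submodule.mem_span_singleton, smul_eq_mul, mul_comm]
  rw [← h2, ← h1]
  let f : L p →+* ZMod (p ^ n) := (PadicInt.toZModPow n).comp (aug p : L p →+* PadicInt p)
  have h3 : M.comap (AddMonoidHom.mulLeft a) = f.toAddMonoidHom.ker := by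
    ext x
    rw [AddSubgroup.mem_comap, AddMonoidHom.mem_ker, AddMonoidHom.coe_mulLeft, h,
      ← Ideal.mem_span_singleton, ← PadicInt.ker_toZModPow]
    rfl
  have hs : Function.Surjective f := ZMod.ringHom_surjective f
  have h4 : f.toAddMonoidHom.range = ⊤ := AddMonoidHom.range_eq_top.2 hs
  rw [h3, AddSubgroup.index_ker, h4, AddSubgroup.card_top, Nat.card_zmod]

lemma span_le (a b : L p) (h : b ∣ a) :
    (Submodule.span (L p) {a}).toAddSubgroup ≤ (Submodule.span (L p) {b}).toAddSubgroup := by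
  have := Ideal.span_singleton_le_span_singleton.2 h
  exact this

lemma index_step (i : ℕ) : (Submodule.span (L p) {π p ^ (i+2)}).toAddSubgroup.relIndex
    (Submodule.span (L p) {π p ^ (i+1)}).toAddSubgroup = p := by
  have := index_of p (Submodule.span (L p) {π p ^ (i+2)}).toAddSubgroup (π p ^ (i+1)) 1 ?_
  · simpa using this
  intro x
  rw [Submodule.mem_toAddSubgroup, pow_one]
  have e : π p ^ (i+1) * x ∈ Submodule.span (L p) {π p ^ (i+2)} ↔ π p ^ (i+2) ∣ π p ^ (i+1) * x :=
    Ideal.mem_span_singleton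
  rw [e]
  constructor
  · rintro ⟨y, hy⟩
    apply not_unit_dvd
    intro hu
    have hu2 : IsUnit (x - π p * y) := by
      apply isUnit_of_aug
      rwa [map_sub, map_mul, aug_π, zero_mul, sub_zero]
    have h0 : π p ^ (i+1) * (x - π p * y) = 0 := by linear_combination hy
    exact π_pow_ne p i ((hu2.mul_left_eq_zero).1 h0)
  · exact step p i x

lemma index_chain (m : ℕ) : (Submodule.span (L p) {π p ^ (m+1)}).toAddSubgroup.relIndex
    (Submodule.span (L p) {π p}).toAddSubgroup = p ^ m := by
  induction m with
  | zero => simp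
  | succ m ih =>
    rw [← AddSubgroup.relIndex_mul_relIndex _ (Submodule.span (L p) {π p ^ (m+1)}).toAddSubgroup,
      ih, index_step, pow_succ']
    · exact span_le p _ _ (pow_dvd_pow _ (by omega))
    · exact span_le p _ _ (dvd_pow_self _ (by omega))

lemma ppow_π (m : ℕ) : π p ^ (m+1) ∣ (p : L p) ^ m * π p := by
  obtain ⟨z, hz⟩ := pπ p
  induction m with
  | zero => simp
  | succ m ih =>
    obtain ⟨y, hy⟩ := ih
    refine ⟨z * y, ?_⟩
    calc (p : L p) ^ (m+1) * π p = p * (p ^ m * π p) := by ring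
      _ = (p * π p) * (π p ^ m * y) := by rw [hy]; ring
      _ = _ := by rw [hz]; ring

lemma ppow_inj {m n : ℕ} (h : p ^ m = p ^ n) : m = n :=
  Nat.pow_right_injective (Fact.out : p.Prime).two_le h

lemma caseB (M : Submodule (L p) (L p)) (hM : M ≠ ⊥) (hπ : ∀ x ∈ M, π p ∣ x) (n : ℕ)
    (htors : Nat.card {x : L p ⧸ M // ∃ k : ℕ, 1 ≤ k ∧ (p : L p) ^ k • x = 0} = p ^ n) :
    M = Submodule.span (L p) {π p ^ (n+1)} := by
  classical
  have hex : ∃ k, π p ^ (k+1) ∈ M := by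
    obtain ⟨x, hx, hx0⟩ := Submodule.exists_mem_ne_zero_of_ne_bot hM
    obtain ⟨k, u, hu, rfl⟩ := exists_unit p x hx0 (hπ x hx)
    obtain ⟨v, hv⟩ := hu.exists_right_inv
    refine ⟨k, ?_⟩
    have := M.smul_mem v hx
    rwa [smul_eq_mul, show v * (π p ^ (k+1) * u) = π p ^ (k+1) by linear_combination π p ^ (k+1) * hv] at this
  obtain ⟨m, hm, hmin⟩ : ∃ m, π p ^ (m+1) ∈ M ∧ ∀ k < m, π p ^ (k+1) ∉ M :=
    ⟨Nat.find hex, Nat.find_spec hex, fun k hk => Nat.find_min hex hk⟩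
  have hMeq : M = Submodule.span (L p) {π p ^ (m+1)} := by
    apply le_antisymm
    · intro x hx
      refine Ideal.mem_span_singleton.2 ?_
      by_cases hx0 : x = 0
      · rw [hx0]; exact dvd_zero _
      obtain ⟨k, u, hu, rfl⟩ := exists_unit p x hx0 (hπ x hx)
      obtain ⟨v, hv⟩ := hu.exists_right_inv
      have := M.smul_mem v hx
      rw [smul_eq_mul, show v * (π p ^ (k+1) * u) = π p ^ (k+1) by linear_combination π p ^ (k+1) * hv] at this
      have hk : m ≤ k := by
        by_contra hlt
        exact hmin k (by omega) this
      exact Dvd.dvd.mul_right (pow_dvd_pow _ (by omega)) _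
    · rw [Submodule.span_le]; simpa using hm
  have hc := card_tors p M (Submodule.span (L p) {π p}).toAddSubgroup ?_ ?_
  · rw [htors, hMeq, index_chain] at hc
    rw [ppow_inj p hc]; exact hMeq
  · intro x
    rw [Submodule.mem_toAddSubgroup]
    have e : x ∈ Submodule.span (L p) {π p} ↔ π p ∣ x := Ideal.mem_span_singleton
    rw [e, ← aug_zero_iff]
    constructor
    · rintro ⟨k, _, hk⟩
      have := (aug_zero_iff p _).2 (hπ _ hk)
      rw [map_mul, map_pow, map_natCast] at this
      exact (mul_eq_zero.1 this).resolve_left (pow_ne_zero _ (pz p))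
    · intro h
      obtain ⟨y, rfl⟩ := (aug_zero_iff p _).1 h
      refine ⟨m + 1, by omega, ?_⟩
      obtain ⟨w, hw⟩ := ppow_π p m
      have := M.smul_mem (p * w * y) hm
      rw [smul_eq_mul] at this
      convert this using 1
      linear_combination p * y * hw
  · intro x hx
    exact Ideal.mem_span_singleton.2 (hπ x hx)

lemma caseA (M : Submodule (L p) (L p)) (hM : M ≠ ⊥) (hπ : ∀ x ∈ M, π p * x = 0) (n : ℕ)
    (htors : Nat.card {x : L p ⧸ M // ∃ k : ℕ, 1 ≤ k ∧ (p : L p) ^ k • x = 0} = p ^ n) :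
    M = Submodule.span (L p) {(p : L p) ^ n * NL p} := by
  let J : Ideal (PadicInt p) :=
    { carrier := {c | am p c * NL p ∈ M}
      zero_mem' := by simp
      add_mem' := by
        intro a b ha hb
        simp only [Set.mem_setOf_eq, map_add, add_mul] at *
        exact M.add_mem ha hb
      smul_mem' := by
        intro c a ha
        simp only [Set.mem_setOf_eq, smul_eq_mul, map_mul] at *
        rw [mul_assoc]
        exact M.smul_mem (am p c) ha }
  have hJ : ∀ c, am p c * NL p ∈ M ↔ c ∈ J := fun c => Iff.rfl
  have hJ0 : J ≠ ⊥ := by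
    obtain ⟨x, hx, hx0⟩ := Submodule.exists_mem_ne_zero_of_ne_bot hM
    obtain ⟨c, rfl⟩ := ann_π p x (hπ x hx)
    intro h
    have : c ∈ J := hx
    rw [h, Ideal.mem_bot] at this
    apply hx0
    rw [this, map_zero, zero_mul]
  obtain ⟨m, hm⟩ := PadicInt.ideal_eq_span_pow_p hJ0
  have hJm : ∀ c, am p c * NL p ∈ M ↔ (p : PadicInt p) ^ m ∣ c := by
    intro c
    rw [hJ, hm, Ideal.mem_span_singleton]
  have hmem : (p : L p) ^ m * NL p ∈ M := by
    have := (hJm (p ^ m)).2 dvd_rfl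
    rwa [map_pow, map_natCast] at this
  have hMeq : M = Submodule.span (L p) {(p : L p) ^ m * NL p} := by
    apply le_antisymm
    · intro x hx
      refine Ideal.mem_span_singleton.2 ?_
      obtain ⟨c, rfl⟩ := ann_π p x (hπ x hx)
      obtain ⟨d, rfl⟩ := (hJm c).1 hx
      refine ⟨am p d, ?_⟩
      rw [map_mul, map_pow, map_natCast]; ring
    · rw [Submodule.span_le]; simpa using hmem
  have hc := card_tors p M (Submodule.span (L p) {NL p}).toAddSubgroup ?_ ?_
  · rw [htors, index_of p _ _ m] at hc
    · rw [ppow_inj p hc]; exact hMeq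
    · intro x
      rw [N_mul, Submodule.mem_toAddSubgroup, hJm]
  · intro x
    rw [Submodule.mem_toAddSubgroup]
    have e : x ∈ Submodule.span (L p) {NL p} ↔ NL p ∣ x := Ideal.mem_span_singleton
    rw [e]
    constructor
    · rintro ⟨k, _, hk⟩
      obtain ⟨c, rfl⟩ := ann_π p x (p_cancel p k _ (by
        have := hπ _ hk
        linear_combination this))
      exact dvd_mul_left _ _
    · rintro ⟨y, rfl⟩
      refine ⟨m + 1, by omega, ?_⟩
      have := M.smul_mem (p * y) hmem
      rw [smul_eq_mul] at this
      convert this using 1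
      ring
  · intro x hx
    obtain ⟨c, rfl⟩ := ann_π p x (hπ x hx)
    exact Ideal.mem_span_singleton.2 (dvd_mul_left _ _)

lemma finite_of_pow (M : Submodule (L p) (L p)) (j : ℕ) (h : (p : L p) ^ j ∈ M) :
    Finite (L p ⧸ M) := by
  let f : L p → (Multiplicative (ZMod p) → ZMod (p ^ j)) :=
    fun x i => PadicInt.toZModPow j (x.coeff i)
  have hf : ∀ x y, f x = f y → M.mkQ x = M.mkQ y := by
    intro x y hxy
    rw [← sub_eq_zero, ← map_sub, Submodule.mkQ_apply, Submodule.Quotient.mk_eq_zero]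
    obtain ⟨z, hz⟩ := dvd_of_coeff p j (x - y) (by
      intro i
      rw [← Ideal.mem_span_singleton, ← PadicInt.ker_toZModPow, RingHom.mem_ker]
      have := congrFun hxy i
      have e : (x - y).coeff i = x.coeff i - y.coeff i := by
        rw [MonoidAlgebra.coeff_sub]; rfl
      rw [e, map_sub, sub_eq_zero]; exact this)
    rw [hz, mul_comm]
    exact M.smul_mem z h
  haveI : NeZero (p ^ j) := ⟨pow_ne_zero _ (Fact.out : p.Prime).ne_zero⟩
  let s := Function.surjInv (Submodule.mkQ_surjective M)
  refine Finite.of_injective (fun q => f (s q)) ?_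
  intro a b hab
  have := hf _ _ hab
  simpa [s, Function.surjInv_eq] using this

lemma caseC (M : Submodule (L p) (L p)) (x y : L p) (hx : x ∈ M) (hy : y ∈ M)
    (hx0 : π p * x ≠ 0) (hy0 : aug p y ≠ 0) : Finite (L p ⧸ M) := by
  obtain ⟨k, u, hu, hk⟩ := exists_unit p _ hx0 (dvd_mul_right _ _)
  obtain ⟨v, hv⟩ := hu.exists_right_inv
  have h1 : π p ^ (k+1) ∈ M := by
    have := M.smul_mem (v * π p) hx
    rwa [smul_eq_mul, show v * π p * x = π p ^ (k+1) by
      linear_combination v * hk + π p ^ (k+1) * hv] at this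
  obtain ⟨m, w, hw⟩ : ∃ m w, aug p y * w = (p : PadicInt p) ^ m := by
    refine ⟨(aug p y).valuation, ((PadicInt.unitCoeff hy0)⁻¹ : (PadicInt p)ˣ), ?_⟩
    have h := PadicInt.unitCoeff_spec hy0
    have h' := Units.mul_inv (PadicInt.unitCoeff hy0)
    linear_combination (((PadicInt.unitCoeff hy0)⁻¹ : (PadicInt p)ˣ) : PadicInt p) * h
      + (p : PadicInt p) ^ (aug p y).valuation * h'
  have h2 : (p : L p) ^ m * NL p ∈ M := by
    have := M.smul_mem (am p w * NL p) hy
    rw [smul_eq_mul, mul_assoc, N_mul, ← mul_assoc, ← map_mul, mul_comm w, hw, map_pow,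
      map_natCast] at this
    exact this
  obtain ⟨z, hz⟩ := exists_z p
  apply finite_of_pow p M (m + (k+1))
  obtain ⟨t, ht⟩ : NL p ∣ (p : L p) ^ (k+1) - (p - NL p) ^ (k+1) := by
    simpa using sub_dvd_pow_sub_pow (p : L p) (p - NL p) (k+1)
  have := M.add_mem (M.smul_mem (p ^ m * z ^ (k+1)) h1) (M.smul_mem t h2)
  simp only [smul_eq_mul] at this
  convert this using 1
  rw [hz, mul_pow] at ht
  rw [pow_add]
  linear_combination (p : L p) ^ m * ht

end S16

/-- if `A = L/M` is infinite and its `p`-torsion submodule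
`T(A) = {x : p^k·x = 0 for some k ≥ 1}` is nonzero of cardinality `p^n` (`n ≥ 1`), then
`M = ⟨p^n·N⟩` or `M = ⟨(g−1)^(n+1)⟩`. -/
theorem stmt_16 (p : ℕ) [Fact p.Prime] (M : Submodule (L p) (L p))
    (hinf : Infinite (L p ⧸ M)) (n : ℕ) (hn : 1 ≤ n)
    (htors : Nat.card {x : L p ⧸ M // ∃ k : ℕ, 1 ≤ k ∧ (p : L p) ^ k • x = 0} = p ^ n) :
    M = Submodule.span (L p) {(p : L p) ^ n * NL p} ∨
      M = Submodule.span (L p) {(gL p - 1) ^ (n + 1)} := by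

  by_cases hM : M = ⊥
  · exfalso
    have hc := S16.card_tors p M M.toAddSubgroup ?_ le_rfl
    · rw [htors, AddSubgroup.relIndex_self] at hc
      have := S16.ppow_inj p (hc.trans (pow_zero p).symm)
      omega
    · intro x
      rw [Submodule.mem_toAddSubgroup, hM, Submodule.mem_bot]
      constructor
      · rintro ⟨k, _, hk⟩
        exact S16.p_cancel p k x hk
      · rintro rfl
        exact ⟨1, le_rfl, by simp⟩
  by_cases hA : ∀ x ∈ M, S16.π p * x = 0
  · exact Or.inl (S16.caseA p M hM hA n htors)
  by_cases hB : ∀ x ∈ M, S16.π p ∣ x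
  · exact Or.inr (S16.caseB p M hM hB n htors)
  exfalso
  push Not at hA hB
  obtain ⟨x, hx, hx0⟩ := hA
  obtain ⟨y, hy, hy0⟩ := hB
  have := S16.caseC p M x y hx hy hx0 (fun h => hy0 ((S16.aug_zero_iff p y).1 h))
  exact not_finite (L p ⧸ M)
end
end
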